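/- Let 𝔤 ⊆ gl(E) be a real Lie subalgebra of endomorphisms of a Euclidean space E that is stable under the adjoint operation X ↦ X*. Then 𝔤 = [𝔤,𝔤] ⊕ z(𝔤), where z(𝔤) is the center of 𝔤, and moreover [𝔤,𝔤] and z(𝔤) are orthogonal with respect to the trace form ⟨X,Y⟩ = tr(X*Y). -/

import Mathlib

/-- The span of commutators of elements of `g`. -/
noncomputable def commutatorSpan {E : Type*} [NormedAddCommGroup E] [InnerProductSpace ℝ E]
    (g : Submodule ℝ (E →ₗ[ℝ] E)) : Submodule ℝ (E →ₗ[ℝ] E) :=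
  Submodule.span ℝ {Z : E →ₗ[ℝ] E | ∃ X ∈ g, ∃ Y ∈ g, Z = X * Y - Y * X}

/-- The centre `z(g) = {X ∈ g | [X,Y] = 0 ∀ Y ∈ g}` of `g`. -/
noncomputable def centerSub {E : Type*} [NormedAddCommGroup E] [InnerProductSpace ℝ E]
    (g : Submodule ℝ (E →ₗ[ℝ] E)) : Submodule ℝ (E →ₗ[ℝ] E) :=
  g ⊓ ⨅ Y ∈ g, LinearMap.ker (LinearMap.mulRight ℝ Y - LinearMap.mulLeft ℝ Y)

open LinearMap in
theorem aux_tr_zero {E : Type*} [NormedAddCommGroup E] [InnerProductSpace ℝ E]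
    [FiniteDimensional ℝ E] (Z : E →ₗ[ℝ] E)
    (h : LinearMap.trace ℝ E (LinearMap.adjoint Z * Z) = 0) : Z = 0 := by
  have b := stdOrthonormalBasis ℝ E
  rw [LinearMap.trace_eq_sum_inner _ b] at h
  simp only [Module.End.mul_apply, LinearMap.adjoint_inner_right, real_inner_self_eq_norm_sq] at h
  rw [Finset.sum_eq_zero_iff_of_nonneg (fun i _ => sq_nonneg _)] at h
  refine b.toBasis.ext fun i => ?_
  simpa using h i (Finset.mem_univ i)

/-- The trace form. -/
noncomputable def auxForm (E : Type*) [NormedAddCommGroup E] [InnerProductSpace ℝ E]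
    [FiniteDimensional ℝ E] : LinearMap.BilinForm ℝ (E →ₗ[ℝ] E) :=
  LinearMap.mk₂ ℝ (fun X Y => LinearMap.trace ℝ E (LinearMap.adjoint X * Y))
    (by intros; simp [add_mul]) (by intros; simp)
    (by intros; simp [mul_add]) (by intros; simp)

theorem auxForm_apply {E : Type*} [NormedAddCommGroup E] [InnerProductSpace ℝ E]
    [FiniteDimensional ℝ E] (X Y : E →ₗ[ℝ] E) :
    auxForm E X Y = LinearMap.trace ℝ E (LinearMap.adjoint X * Y) := rfl

theorem auxForm_symm {E : Type*} [NormedAddCommGroup E] [InnerProductSpace ℝ E]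
    [FiniteDimensional ℝ E] (X Y : E →ₗ[ℝ] E) : auxForm E X Y = auxForm E Y X := by
  have b := stdOrthonormalBasis ℝ E
  simp only [auxForm_apply, LinearMap.trace_eq_sum_inner _ b, Module.End.mul_apply,
    LinearMap.adjoint_inner_right]
  exact Finset.sum_congr rfl fun i _ => real_inner_comm _ _

theorem aux_adj_mul {E : Type*} [NormedAddCommGroup E] [InnerProductSpace ℝ E]
    [FiniteDimensional ℝ E] (X Y : E →ₗ[ℝ] E) :
    LinearMap.adjoint (X * Y) = LinearMap.adjoint Y * LinearMap.adjoint X :=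
  LinearMap.adjoint_comp X Y

theorem aux_mem_center {E : Type*} [NormedAddCommGroup E] [InnerProductSpace ℝ E]
    (g : Submodule ℝ (E →ₗ[ℝ] E)) (X : E →ₗ[ℝ] E) :
    X ∈ centerSub g ↔ X ∈ g ∧ ∀ Y ∈ g, X * Y - Y * X = 0 := by
  simp [centerSub, Submodule.mem_iInf]

/-- A Lie subalgebra `𝔤 ⊆ gl(E)` stable under adjoint decomposes as
`𝔤 = [𝔤,𝔤] ⊕ z(𝔤)`, and the two summands are orthogonal for the trace form
`⟨X,Y⟩ = tr(X*Y)`. -/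
theorem selfadjoint_lie_subalgebra_decomposition
    {E : Type*} [NormedAddCommGroup E] [InnerProductSpace ℝ E] [FiniteDimensional ℝ E]
    (g : Submodule ℝ (E →ₗ[ℝ] E))
    (hbr : ∀ X ∈ g, ∀ Y ∈ g, X * Y - Y * X ∈ g)
    (hadj : ∀ X ∈ g, LinearMap.adjoint X ∈ g) :
    commutatorSpan g ⊔ centerSub g = g ∧
    commutatorSpan g ⊓ centerSub g = ⊥ ∧
    ∀ X ∈ commutatorSpan g, ∀ Y ∈ centerSub g,
      LinearMap.trace ℝ E (LinearMap.adjoint X * Y) = 0 := by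
  have hle : commutatorSpan g ≤ g := by
    refine Submodule.span_le.2 ?_
    rintro _ ⟨X, hX, Y, hY, rfl⟩
    exact hbr X hX Y hY
  have horth : ∀ X ∈ commutatorSpan g, ∀ Y ∈ centerSub g,
      LinearMap.trace ℝ E (LinearMap.adjoint X * Y) = 0 := by
    intro X hX Y hY
    rw [aux_mem_center] at hY
    have : commutatorSpan g ≤ LinearMap.ker ((auxForm E).flip Y) := by
      refine Submodule.span_le.2 ?_
      rintro _ ⟨A, hA, B, hB, rfl⟩
      change LinearMap.trace ℝ E (LinearMap.adjoint (A * B - B * A) * Y) = 0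
      have h1 := sub_eq_zero.1 (hY.2 _ (hadj A hA))
      rw [map_sub, aux_adj_mul, aux_adj_mul, sub_mul, map_sub, mul_assoc, mul_assoc,
        LinearMap.trace_mul_comm ℝ (LinearMap.adjoint A), mul_assoc, h1, sub_self]
    exact this hX
  have hcompl : IsCompl (commutatorSpan g) ((auxForm E).orthogonal (commutatorSpan g)) := by
    have hr : (auxForm E).IsRefl := fun X Y h => by rw [auxForm_symm, h]
    refine LinearMap.BilinForm.isCompl_orthogonal_of_restrict_nondegenerate hr ?_
    refine ⟨fun x hx => ?_, fun x hx => ?_⟩ <;>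
    exact Subtype.ext (aux_tr_zero x.1 (hx x))
  refine ⟨le_antisymm (sup_le hle inf_le_left) ?_, ?_, horth⟩
  · intro X hX
    obtain ⟨w, hw, u, hu, rfl⟩ := Submodule.mem_sup.1
      (hcompl.sup_eq_top ▸ Submodule.mem_top : X ∈ _ ⊔ _)
    refine Submodule.add_mem_sup hw ?_
    have hug : u ∈ g := by simpa using g.sub_mem hX (hle hw)
    refine (aux_mem_center g u).2 ⟨hug, fun A hA => aux_tr_zero _ ?_⟩
    set Z := u * A - A * u with hZ
    have hZg : Z ∈ g := hbr u hug A hA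
    have h2 : LinearMap.trace ℝ E
        (LinearMap.adjoint (Z * LinearMap.adjoint A - LinearMap.adjoint A * Z) * u) = 0 :=
      hu _ (Submodule.subset_span ⟨Z, hZg, _, hadj A hA, rfl⟩)
    rw [map_sub, aux_adj_mul, aux_adj_mul, LinearMap.adjoint_adjoint, sub_mul, map_sub,
      mul_assoc, mul_assoc, LinearMap.trace_mul_comm ℝ A, mul_assoc] at h2
    conv_lhs => rw [hZ, mul_sub, map_sub, ← hZ]
    exact h2
  · rw [eq_bot_iff]
    rintro X ⟨h1, h2⟩
    exact aux_tr_zero X (horth X h1 X h2)
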